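/- arXiv:1903.07896 — 4 statements merged into one kernel-verified Lean document; each statement's English description precedes it below -/
import Mathlib

section
/- Let α > −1 be real and let i, j be natural numbers with i ≤ j. For every natural number k, the summand 9(j+1−i+k)(j+2−i+k)(k+1)(k+2) / [(j+1+k+α)(j+2+k+α)(j+3+k+α)(j+4+k+α)(j+5+k+α)(j+6+k+α)] equals s(k) − s(k+1), where s(k) := (a k⁴ + b k³ + c k² + d k + e) / [(j+1+k+α)(j+2+k+α)(j+3+k+α)(j+4+k+α)(j+5+k+α)] with a = 9, b = 9(8+2α−i+3j), c = 3(71−15i+i²+57j−5ij+10j²+42α+6α²−3αi+15αj), d = (3/2)(180−48i+6i²+236j−36ij+i²j+90j²−5ij²+10j³+188α+60α²+6α³−24αi−3α²i+αi²+144αj+21α²j−8αij+25αj²), and e = (3/10)(4+j+α)(5+j+α)(20+24α+6α²−6i−3αi+i²+30j+15αj−5ij+10j²). -/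
/-- The partial-fraction term `s(k)` used to telescope the series for the
`(i,j)` entry of `M* P M`. -/
noncomputable def sTerm (α : ℝ) (i j k : ℕ) : ℝ :=
  let I : ℝ := i
  let J : ℝ := j
  let K : ℝ := k
  let a : ℝ := 9
  let b : ℝ := 9 * (8 + 2 * α - I + 3 * J)
  let c : ℝ := 3 * (71 - 15 * I + I ^ 2 + 57 * J - 5 * I * J + 10 * J ^ 2
    + 42 * α + 6 * α ^ 2 - 3 * α * I + 15 * α * J)
  let d : ℝ := (3 / 2) * (180 - 48 * I + 6 * I ^ 2 + 236 * J - 36 * I * J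
    + I ^ 2 * J + 90 * J ^ 2 - 5 * I * J ^ 2 + 10 * J ^ 3 + 188 * α
    + 60 * α ^ 2 + 6 * α ^ 3 - 24 * α * I - 3 * α ^ 2 * I + α * I ^ 2
    + 144 * α * J + 21 * α ^ 2 * J - 8 * α * I * J + 25 * α * J ^ 2)
  let e : ℝ := (3 / 10) * (4 + J + α) * (5 + J + α) * (20 + 24 * α
    + 6 * α ^ 2 - 6 * I - 3 * α * I + I ^ 2 + 30 * J + 15 * α * J
    - 5 * I * J + 10 * J ^ 2)
  (a * K ^ 4 + b * K ^ 3 + c * K ^ 2 + d * K + e) /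
    ((J + 1 + K + α) * (J + 2 + K + α) * (J + 3 + K + α) * (J + 4 + K + α) *
      (J + 5 + K + α))

/-- Two fractions over overlapping products of five consecutive factors differ by a fraction over
the product of all six. -/
lemma div_six_eq_sub_of_mul_sub_mul_eq {F : Type*} [Field F] {p q r x₁ x₂ x₃ x₄ x₅ x₆ : F}
    (h₁ : x₁ ≠ 0) (h₂ : x₂ ≠ 0) (h₃ : x₃ ≠ 0) (h₄ : x₄ ≠ 0) (h₅ : x₅ ≠ 0) (h₆ : x₆ ≠ 0)
    (h : p * x₆ - q * x₁ = r) :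
    r / (x₁ * x₂ * x₃ * x₄ * x₅ * x₆) =
      p / (x₁ * x₂ * x₃ * x₄ * x₅) - q / (x₂ * x₃ * x₄ * x₅ * x₆) := by
  rw [← h]
  field_simp

/-- The summand of the series for the `(i,j)` entry of `M* P M` telescopes as
`s(k) - s(k+1)`. -/
theorem stmt_8 (α : ℝ) (hα : -1 < α) (i j : ℕ) (hij : i ≤ j) (k : ℕ) :
    9 * ((j : ℝ) + 1 - i + k) * ((j : ℝ) + 2 - i + k) * ((k : ℝ) + 1) *
        ((k : ℝ) + 2) /
      (((j : ℝ) + 1 + k + α) * ((j : ℝ) + 2 + k + α) * ((j : ℝ) + 3 + k + α) *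
        ((j : ℝ) + 4 + k + α) * ((j : ℝ) + 5 + k + α) * ((j : ℝ) + 6 + k + α))
    = sTerm α i j k - sTerm α i j (k + 1) := by
  have hj : (0 : ℝ) ≤ j := j.cast_nonneg
  have hk : (0 : ℝ) ≤ k := k.cast_nonneg
  have shift (c : ℝ) : (j : ℝ) + c + (k + 1) + α = j + (c + 1) + k + α := by ring
  simp only [sTerm, Nat.cast_add, Nat.cast_one, shift]
  norm_num only
  apply div_six_eq_sub_of_mul_sub_mul_eq
  case h => ring
  all_goals exact ne_of_gt (by linarith)
end

section
/- Let α > −1 be real and let i, j be natural numbers with i ≤ j. Then the infinite series Σ_{k=0}^{∞} 9(j+1−i+k)(j+2−i+k)(k+1)(k+2) / [(j+1+k+α)(j+2+k+α)(j+3+k+α)(j+4+k+α)(j+5+k+α)(j+6+k+α)] converges, and its sum equals 3(20+24α+6α²−6i−3αi+i²+30j+15αj−5ij+10j²) / [10(j+1+α)(j+2+α)(j+3+α)]. -/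
/-- An antidifference, up to sign, of
`9 (x+1-s)(x+2-s)(x+1-t)(x+2-t) / ((x+1)(x+2)(x+3)(x+4)(x+5)(x+6))`. -/
noncomputable def antidifference (s t x : ℝ) : ℝ :=
  9 * (s * (s - 1) * t * (t - 1) / 5 * ((x + 1)⁻¹ * (x + 2)⁻¹ * (x + 3)⁻¹ * (x + 4)⁻¹ * (x + 5)⁻¹)
    - s * t * (s + t) / 2 * ((x + 2)⁻¹ * (x + 3)⁻¹ * (x + 4)⁻¹ * (x + 5)⁻¹)
    + (s * (s - 1) + 4 * s * (t + 1) + (t + 1) * (t + 2)) / 3 *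
        ((x + 3)⁻¹ * (x + 4)⁻¹ * (x + 5)⁻¹)
    - (s + t + 2) * ((x + 4)⁻¹ * (x + 5)⁻¹)
    + (x + 5)⁻¹)

lemma antidifference_sub_antidifference_add_one (s t : ℝ) {x : ℝ} (hx : -1 < x) :
    antidifference s t x - antidifference s t (x + 1) =
      9 * (x + 1 - s) * (x + 2 - s) * (x + 1 - t) * (x + 2 - t) /
        ((x + 1) * (x + 2) * (x + 3) * (x + 4) * (x + 5) * (x + 6)) := by
  have h1 : x + 1 ≠ 0 := by linarith
  have h2 : x + 2 ≠ 0 := by linarith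
  have h3 : x + 3 ≠ 0 := by linarith
  have h4 : x + 4 ≠ 0 := by linarith
  have h5 : x + 5 ≠ 0 := by linarith
  have h6 : x + 6 ≠ 0 := by linarith
  rw [antidifference, antidifference, show x + 1 + 1 = x + 2 by ring,
    show x + 1 + 2 = x + 3 by ring, show x + 1 + 3 = x + 4 by ring,
    show x + 1 + 4 = x + 5 by ring, show x + 1 + 5 = x + 6 by ring]
  field_simp
  ring

lemma antidifference_self (s : ℝ) {t : ℝ} (ht : -1 < t) :
    antidifference s t t =
      3 * (20 - 6 * s + 30 * t + s ^ 2 - 5 * s * t + 10 * t ^ 2) /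
        (10 * ((t + 1) * (t + 2) * (t + 3))) := by
  have h1 : t + 1 ≠ 0 := by linarith
  have h2 : t + 2 ≠ 0 := by linarith
  have h3 : t + 3 ≠ 0 := by linarith
  have h4 : t + 4 ≠ 0 := by linarith
  have h5 : t + 5 ≠ 0 := by linarith
  rw [antidifference]
  field_simp
  ring

open Filter Topology in
lemma tendsto_antidifference_atTop (s t : ℝ) :
    Tendsto (antidifference s t) atTop (𝓝 0) := by
  have h (c : ℝ) : Tendsto (fun x : ℝ => (x + c)⁻¹) atTop (𝓝 0) :=
    tendsto_inv_atTop_zero.comp (tendsto_atTop_add_const_right _ c tendsto_id)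
  have h2 := (h 4).mul (h 5)
  have h3 := ((h 3).mul (h 4)).mul (h 5)
  have h4 := (((h 2).mul (h 3)).mul (h 4)).mul (h 5)
  have h5 := ((((h 1).mul (h 2)).mul (h 3)).mul (h 4)).mul (h 5)
  unfold antidifference
  simpa using
    (((((h5.const_mul (s * (s - 1) * t * (t - 1) / 5)).sub
      (h4.const_mul (s * t * (s + t) / 2))).add
      (h3.const_mul ((s * (s - 1) + 4 * s * (t + 1) + (t + 1) * (t + 2)) / 3))).sub
      (h2.const_mul (s + t + 2))).add (h 5)).const_mul 9


/-- For `α > -1` and natural numbers `i ≤ j`, the series giving the `(i,j)`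
entry of `M* P M` converges to
`3(20+24α+6α²-6i-3αi+i²+30j+15αj-5ij+10j²) / (10(j+1+α)(j+2+α)(j+3+α))`. -/
theorem stmt_9 (α : ℝ) (hα : -1 < α) (i j : ℕ) (hij : i ≤ j) :
    HasSum
      (fun k : ℕ =>
        9 * ((j : ℝ) + 1 - i + k) * ((j : ℝ) + 2 - i + k) * ((k : ℝ) + 1) *
            ((k : ℝ) + 2) /
          (((j : ℝ) + 1 + k + α) * ((j : ℝ) + 2 + k + α) *
            ((j : ℝ) + 3 + k + α) * ((j : ℝ) + 4 + k + α) *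
            ((j : ℝ) + 5 + k + α) * ((j : ℝ) + 6 + k + α)))
      (3 * (20 + 24 * α + 6 * α ^ 2 - 6 * (i : ℝ) - 3 * α * i + (i : ℝ) ^ 2
          + 30 * (j : ℝ) + 15 * α * j - 5 * (i : ℝ) * j + 10 * (j : ℝ) ^ 2) /
        (10 * (((j : ℝ) + 1 + α) * ((j : ℝ) + 2 + α) * ((j : ℝ) + 3 + α)))) := by
  have hj : (0 : ℝ) ≤ j := j.cast_nonneg
  have hij' : (i : ℝ) ≤ j := by exact_mod_cast hij
  rw [hasSum_iff_tendsto_nat_of_nonneg]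
  · have hsum (n : ℕ) := Finset.sum_range_sub'
      (fun k : ℕ => antidifference (i + α) (j + α) (j + α + k)) n
    have hlim : Filter.Tendsto (fun n : ℕ => antidifference (i + α) (j + α) (j + α + n))
        Filter.atTop (nhds 0) :=
      (tendsto_antidifference_atTop _ _).comp
        (Filter.tendsto_atTop_add_const_left _ _ tendsto_natCast_atTop_atTop)
    convert hlim.const_sub (antidifference (i + α) (j + α) (j + α)) using 1
    · funext n
      have h0 := hsum n
      simp only [Nat.cast_zero, add_zero] at h0
      rw [← h0]
      refine Finset.sum_congr rfl fun k _ => ?_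
      have hk : (0 : ℝ) ≤ k := k.cast_nonneg
      rw [Nat.cast_succ, ← add_assoc,
        antidifference_sub_antidifference_add_one _ _ (by linarith)]
      congr 1 <;> ring
    · rw [sub_zero, antidifference_self _ (by linarith)]
      congr 2 <;> ring
  · intro k
    have hk : (0 : ℝ) ≤ k := k.cast_nonneg
    have ha : 0 < 1 + α := by linarith
    have hd : (0 : ℝ) ≤ j - i := by linarith
    have hpos (c : ℝ) (hc : 1 ≤ c) : 0 ≤ (j : ℝ) + c + k + α := by linarith
    have h1 : (0 : ℝ) ≤ j + 1 - i + k := by linarith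
    have h2 : (0 : ℝ) ≤ j + 2 - i + k := by linarith
    have := hpos 1 (by norm_num)
    have := hpos 2 (by norm_num)
    have := hpos 3 (by norm_num)
    have := hpos 4 (by norm_num)
    have := hpos 5 (by norm_num)
    have := hpos 6 (by norm_num)
    positivity
end

section
/- For every real number α > −1, the 3×3 real symmetric matrix Q₃ = [q_{ij}]_{0≤i,j≤2} with q₀₀ = (10+12α+3α²)(1+α)(2+α)(3+α)/60, q₀₁ = q₁₀ = −α(11+4α)(1+α)(2+α)(3+α)/40, q₀₂ = q₂₀ = α(3+2α)(1+α)(2+α)(3+α)/40, q₁₁ = (5−α+15α²+6α³)(2+α)(3+α)/30, q₁₂ = q₂₁ = −α(1+α)(2+α)(3+α)(1+4α)/40, q₂₂ = (20−6α+7α²+6α³+3α⁴)(3+α)/60 is positive definite. -/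
/-- The 3×3 upper-left block `Q₃` of the interrupter `Q` for `(C^(α), 3)`. -/
noncomputable def Q3 (α : ℝ) : Matrix (Fin 3) (Fin 3) ℝ :=
  !![(10 + 12 * α + 3 * α ^ 2) * (1 + α) * (2 + α) * (3 + α) / 60,
      -α * (11 + 4 * α) * (1 + α) * (2 + α) * (3 + α) / 40,
      α * (3 + 2 * α) * (1 + α) * (2 + α) * (3 + α) / 40;
    -α * (11 + 4 * α) * (1 + α) * (2 + α) * (3 + α) / 40,
      (5 - α + 15 * α ^ 2 + 6 * α ^ 3) * (2 + α) * (3 + α) / 30,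
      -α * (1 + α) * (2 + α) * (3 + α) * (1 + 4 * α) / 40;
    α * (3 + 2 * α) * (1 + α) * (2 + α) * (3 + α) / 40,
      -α * (1 + α) * (2 + α) * (3 + α) * (1 + 4 * α) / 40,
      (20 - 6 * α + 7 * α ^ 2 + 6 * α ^ 3 + 3 * α ^ 4) * (3 + α) / 60]

/-- Sylvester's criterion for real symmetric `3 × 3` matrices. -/
theorem Matrix.posDef_fin_three_of_leadingMinors_pos {a b c d e f : ℝ} (h₁ : 0 < a)
    (h₂ : 0 < a * d - b ^ 2)
    (h₃ : 0 < a * (d * f - e ^ 2) - b * (b * f - c * e) + c * (b * e - c * d)) :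
    (!![a, b, c; b, d, e; c, e, f] : Matrix (Fin 3) (Fin 3) ℝ).PosDef := by
  refine .of_dotProduct_mulVec_pos ?_ fun v hv ↦ ?_
  · ext i j
    fin_cases i <;> fin_cases j <;> simp
  · simp only [dotProduct, Matrix.mulVec, Fin.sum_univ_three, Matrix.of_apply, Matrix.cons_val,
      star_trivial]
    generalize hx : v 0 = x
    generalize hy : v 1 = y
    generalize hz : v 2 = z
    refine pos_of_mul_pos_right (a := a * (a * d - b ^ 2)) ?_ (mul_pos h₁ h₂).le
    have key : a * (a * d - b ^ 2) * (x * (a * x + b * y + c * z) + y * (b * x + d * y + e * z) +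
          z * (c * x + e * y + f * z)) =
        (a * d - b ^ 2) * (a * x + b * y + c * z) ^ 2 +
          ((a * d - b ^ 2) * y + (a * e - b * c) * z) ^ 2 +
          a * (a * (d * f - e ^ 2) - b * (b * f - c * e) + c * (b * e - c * d)) * z ^ 2 := by
      ring
    rw [key]
    rcases eq_or_ne z 0 with rfl | hz0
    · rcases eq_or_ne y 0 with rfl | hy0
      · have hx0 : x ≠ 0 := by
          rintro rfl
          exact hv (funext fun i ↦ by fin_cases i <;> assumption)
        simp only [mul_zero, add_zero]
        positivity
      · simp only [mul_zero, add_zero]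
        positivity
    · positivity

/-- For `α > -1`, the matrix `Q₃` is positive definite. -/
theorem stmt_10 (α : ℝ) (hα : -1 < α) : (Q3 α).PosDef := by
  obtain ⟨t, rfl⟩ : ∃ t, α = t - 1 := ⟨α + 1, by ring⟩
  have ht : 0 < t := by linarith
  refine Matrix.posDef_fin_three_of_leadingMinors_pos ?_ ?_ ?_
  · have h : 0 < (1 + 6 * t + 3 * t ^ 2) * t * (t + 1) * (t + 2) / 60 := by positivity
    convert h using 1
    ring
  · have h : 0 < (120 + 175 * t + 90 * t ^ 2 + 15 * t ^ 3) * t * (t + 1) ^ 2 * (t + 2) ^ 2 /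
        120 ^ 2 := by positivity
    convert h using 1
    ring
  · have h : 0 < (7200 + 6600 * t + 2000 * t ^ 2 + 200 * t ^ 3) * t * (t + 1) ^ 2 * (t + 2) ^ 3 /
        120 ^ 3 := by positivity
    convert h using 1
    ring
end

section
/- For every real number α with α = 0, α = 1, or α ≥ 2, the 3×3 real symmetric matrix Q₃ − I is positive semidefinite, where Q₃ = [q_{ij}]_{0≤i,j≤2} has q₀₀ = (10+12α+3α²)(1+α)(2+α)(3+α)/60, q₀₁ = q₁₀ = −α(11+4α)(1+α)(2+α)(3+α)/40, q₀₂ = q₂₀ = α(3+2α)(1+α)(2+α)(3+α)/40, q₁₁ = (5−α+15α²+6α³)(2+α)(3+α)/30, q₁₂ = q₂₁ = −α(1+α)(2+α)(3+α)(1+4α)/40, q₂₂ = (20−6α+7α²+6α³+3α⁴)(3+α)/60, and I is the 3×3 identity matrix. -/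
/-- A ternary quadratic form whose trailing principal minors are positive, positive and
nonnegative takes only nonnegative values. -/
theorem ternary_form_nonneg {a b c d e g : ℝ} (hg : 0 < g) (hdg : 0 < d * g - e ^ 2)
    (hdet : 0 ≤ a * d * g + 2 * b * c * e - a * e ^ 2 - g * b ^ 2 - d * c ^ 2) (x y z : ℝ) :
    0 ≤ a * x ^ 2 + d * y ^ 2 + g * z ^ 2 + 2 * b * x * y + 2 * c * x * z + 2 * e * y * z := by
  refine (mul_nonneg_iff_of_pos_left (mul_pos hg hdg)).mp ?_
  have key : g * (d * g - e ^ 2) *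
      (a * x ^ 2 + d * y ^ 2 + g * z ^ 2 + 2 * b * x * y + 2 * c * x * z + 2 * e * y * z) =
      (d * g - e ^ 2) * (c * x + e * y + g * z) ^ 2 +
      ((d * g - e ^ 2) * y + (b * g - c * e) * x) ^ 2 +
      g * (a * d * g + 2 * b * c * e - a * e ^ 2 - g * b ^ 2 - d * c ^ 2) * x ^ 2 := by
    ring
  rw [key]
  positivity

theorem posSemidef_of_ternary_form_nonneg {a b c d e g : ℝ}
    (h : ∀ x y z : ℝ,
      0 ≤ a * x ^ 2 + d * y ^ 2 + g * z ^ 2 + 2 * b * x * y + 2 * c * x * z + 2 * e * y * z) :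
    (!![a, b, c; b, d, e; c, e, g] : Matrix (Fin 3) (Fin 3) ℝ).PosSemidef := by
  refine Matrix.PosSemidef.of_dotProduct_mulVec_nonneg ?_ fun v => ?_
  · ext i j
    fin_cases i <;> fin_cases j <;> rfl
  · have hv := h (v 0) (v 1) (v 2)
    simp [Matrix.mulVec, dotProduct, Fin.sum_univ_three]
    linarith

theorem Q3_sub_one_eq (α : ℝ) :
    Q3 α - 1 =
      !![(10 + 12 * α + 3 * α ^ 2) * (1 + α) * (2 + α) * (3 + α) / 60 - 1,
          -α * (11 + 4 * α) * (1 + α) * (2 + α) * (3 + α) / 40,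
          α * (3 + 2 * α) * (1 + α) * (2 + α) * (3 + α) / 40;
        -α * (11 + 4 * α) * (1 + α) * (2 + α) * (3 + α) / 40,
          (5 - α + 15 * α ^ 2 + 6 * α ^ 3) * (2 + α) * (3 + α) / 30 - 1,
          -α * (1 + α) * (2 + α) * (3 + α) * (1 + 4 * α) / 40;
        α * (3 + 2 * α) * (1 + α) * (2 + α) * (3 + α) / 40,
          -α * (1 + α) * (2 + α) * (3 + α) * (1 + 4 * α) / 40,
          (20 - 6 * α + 7 * α ^ 2 + 6 * α ^ 3 + 3 * α ^ 4) * (3 + α) / 60 - 1] := by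
  ext i j
  fin_cases i <;> fin_cases j <;> simp [Q3]

/-- For `α ∈ {0, 1} ∪ [2, ∞)`, the matrix `Q₃ - I` is positive semidefinite. -/
theorem stmt_15 (α : ℝ) (hα : α = 0 ∨ α = 1 ∨ 2 ≤ α) :
    (Q3 α - 1).PosSemidef := by
  rw [Q3_sub_one_eq]
  refine posSemidef_of_ternary_form_nonneg fun x y z => ?_
  rcases hα with rfl | rfl | hα
  · norm_num
  · nlinarith only [sq_nonneg (3 * x - 3 * y + z)]
  · obtain ⟨t, ht, rfl⟩ : ∃ t : ℝ, 0 ≤ t ∧ α = 2 + t := ⟨α - 2, by linarith, by ring⟩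
    apply ternary_form_nonneg
    · ring_nf
      positivity
    · ring_nf
      positivity
    · ring_nf
      positivity
end
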